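/- arXiv:1907.03565 — 10 statements merged into one kernel-verified Lean document; each statement's English description precedes it below -/
import Mathlib

section
/- Let n ≥ 1, let E be a digraph on Fin n such that every dominating set of E has cardinality at least k+1, let I be a type, and let t ≥ 1. Let x_0, x_1, …, x_t : Fin n → I be pairwise distinct input assignments such that for every i ∈ {1,…,t}, the assignment x_i differs from x_0 in exactly one coordinate. Then the set { j ∈ Fin n : view E x_i j = view E x_0 j for every i ∈ {0,…,t} } has cardinality at least k + 1 − t. -/
open Classical in
/-- The view of process `i` in the information-flow digraph `E` on input assignment `x`. -/
noncomputable def view {V I : Type*} (E : V → V → Prop) (x : V → I) (i j : V) : Option I :=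
  if j = i ∨ E j i then some (x j) else none

/-- `D` is a dominating set of the digraph `E`: every vertex is in `D` or has an in-neighbor
in `D`. -/
def IsDominating {n : ℕ} (E : Fin n → Fin n → Prop) (D : Finset (Fin n)) : Prop :=
  ∀ v : Fin n, v ∈ D ∨ ∃ u ∈ D, E u v

/-- Two assignments giving process `v` different views differ at `v` or at an in-neighbor of `v`. -/
theorem exists_ne_of_view_ne {V I : Type*} {E : V → V → Prop} {x y : V → I} {v : V}
    (h : view E x v ≠ view E y v) : ∃ j, (j = v ∨ E j v) ∧ y j ≠ x j := by
  by_contra! hc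
  refine h (funext fun j => ?_)
  unfold view
  split_ifs with hj
  · rw [hc j hj]
  · rfl

/-- **Lemma (depth of scissor cuts).** If every dominating set of the information-flow graph
has cardinality at least `k + 1`, and `x 1, …, x t` are distinct facets each sharing an
`(n-2)`-face with `x 0`, then the common intersection of their images under the scissor-cut
map (i.e., the set of processes whose views coincide in all `t + 1` executions) has
cardinality at least `k + 1 - t`. -/
theorem scissor_cut_depth {n k : ℕ} (hn : 1 ≤ n) (E : Fin n → Fin n → Prop)
    (hdom : ∀ D : Finset (Fin n), IsDominating E D → k + 1 ≤ D.card)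
    {I : Type*} {t : ℕ} (ht : 1 ≤ t) (x : ℕ → Fin n → I)
    (hdistinct : ∀ i i' : ℕ, i ≤ t → i' ≤ t → i ≠ i' → x i ≠ x i')
    (hshare : ∀ i : ℕ, 1 ≤ i → i ≤ t → ∃! j : Fin n, x 0 j ≠ x i j) :
    k + 1 - t ≤ {j : Fin n | ∀ i : ℕ, i ≤ t → view E (x i) j = view E (x 0) j}.ncard := by
  classical
  have : Nonempty (Fin n) := ⟨⟨0, hn⟩⟩
  choose! d _ hd using hshare
  set S := {j : Fin n | ∀ i : ℕ, i ≤ t → view E (x i) j = view E (x 0) j} with hS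
  have hdominating : IsDominating E (S.toFinset ∪ (Finset.Icc 1 t).image d) := by
    intro v
    by_cases hv : v ∈ S
    · exact Or.inl (Finset.mem_union_left _ (Set.mem_toFinset.2 hv))
    · simp only [hS, Set.mem_ofPred_eq, not_forall] at hv
      obtain ⟨i, hit, hne⟩ := hv
      have hi : 1 ≤ i := Nat.one_le_iff_ne_zero.2 fun h => hne (by rw [h])
      obtain ⟨j, hj, hxj⟩ := exists_ne_of_view_ne hne
      have hmem : j ∈ S.toFinset ∪ (Finset.Icc 1 t).image d :=
        Finset.mem_union_right _
          (Finset.mem_image.2 ⟨i, Finset.mem_Icc.2 ⟨hi, hit⟩, (hd i hi hit j hxj).symm⟩)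
      rcases hj with rfl | hj
      · exact Or.inl hmem
      · exact Or.inr ⟨j, hmem, hj⟩
  have hcard := hdom _ hdominating
  have hunion := Finset.card_union_le S.toFinset ((Finset.Icc 1 t).image d)
  have himage : ((Finset.Icc 1 t).image d).card ≤ t :=
    Finset.card_image_le.trans (by simp)
  rw [Set.ncard_eq_toFinset_card']
  omega
end

section
/- Let n ≥ 1, let E be a digraph on Fin n, let I be a type, and let t ≥ 1. Let x_0, x_1, …, x_t : Fin n → I be pairwise distinct input assignments such that for every i ∈ {1,…,t}, the assignment x_i differs from x_0 in exactly one coordinate, and let p_i ∈ Fin n be the unique coordinate where x_i and x_0 differ. Let S = { j ∈ Fin n : view E x_i j = view E x_0 j for every i ∈ {0,…,t} }. Then S ∪ {p_1,…,p_t} is a dominating set of E. -/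
/-- `D` is a dominating set of the digraph `E`: every vertex is in `D` or has an in-neighbor
in `D`. -/
def IsDominatingSet {n : ℕ} (E : Fin n → Fin n → Prop) (D : Set (Fin n)) : Prop :=
  ∀ v : Fin n, v ∈ D ∨ ∃ u ∈ D, E u v

/-- **Lemma.** Let `x 0, x 1, …, x t` be pairwise distinct input assignments such that
each `x i` (for `1 ≤ i ≤ t`) differs from `x 0` exactly at coordinate `p i`. Then the set
`S` of processes whose views agree in all the executions, together with `{p 1, …, p t}`,
forms a dominating set of the information-flow digraph `E`. -/
theorem views_union_diff_coords_dominating {n : ℕ} (hn : 1 ≤ n)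
    (E : Fin n → Fin n → Prop) {I : Type*} {t : ℕ} (ht : 1 ≤ t)
    (x : ℕ → Fin n → I) (p : ℕ → Fin n)
    (hdistinct : ∀ i i' : ℕ, i ≤ t → i' ≤ t → i ≠ i' → x i ≠ x i')
    (hdiff : ∀ i : ℕ, 1 ≤ i → i ≤ t →
      x i (p i) ≠ x 0 (p i) ∧ ∀ j : Fin n, j ≠ p i → x i j = x 0 j) :
    IsDominatingSet E
      ({j : Fin n | ∀ i : ℕ, i ≤ t → view E (x i) j = view E (x 0) j} ∪
       {q : Fin n | ∃ i : ℕ, 1 ≤ i ∧ i ≤ t ∧ p i = q}) := by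
  intro v
  by_cases hv : ∀ i : ℕ, i ≤ t → view E (x i) v = view E (x 0) v
  · exact Or.inl (Or.inl hv)
  push Not at hv
  obtain ⟨i, hit, hview⟩ := hv
  obtain ⟨k, hk⟩ := Function.ne_iff.mp hview
  have hi : 1 ≤ i := by
    rw [Nat.one_le_iff_ne_zero]
    rintro rfl
    exact hk rfl
  have hkp : k = p i := by
    by_contra hne
    exact hk (by simp only [view, (hdiff i hi hit).2 k hne])
  have hheard : k = v ∨ E k v := by
    by_contra hnot
    exact hk (by simp only [view, if_neg hnot])
  have hmem : ∃ i : ℕ, 1 ≤ i ∧ i ≤ t ∧ p i = k := ⟨i, hi, hit, hkp.symm⟩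
  rcases hheard with rfl | hE
  · exact Or.inl (Or.inr hmem)
  · exact Or.inr ⟨k, Or.inr hmem, hE⟩
end

section
/- Let n ≥ 1 and k ≥ 1, let E be a digraph on Fin n, and let I be a type having at least k+1 distinct elements. If E has no dominating set of cardinality at most k (i.e., the domination number of E is strictly greater than k), then no decision function f : (i : Fin n) → (Fin n → Option I) → I solves k-set agreement on E. (In particular, this holds even when the number of input values is exactly k+1, e.g., for binary consensus when k = 1.) -/
/-- A decision function `f` solves `k`-set agreement on the information-flow digraph `E`:
for every input assignment, each decided value is one of the input values (validity), and
at most `k` distinct values are decided (agreement). -/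
def SolvesSetAgreement {n : ℕ} {I : Type*} (k : ℕ) (E : Fin n → Fin n → Prop)
    (f : (i : Fin n) → (Fin n → Option I) → I) : Prop :=
  ∀ x : Fin n → I,
    (∀ i : Fin n, f i (view E x i) ∈ Set.range x) ∧
    (Set.range fun i : Fin n => f i (view E x i)).ncard ≤ k

/-! ### Chains on products of simplices

A list of finsets encodes a product of simplices, one factor per entry. Cochains on such cells are
functions `List (Finset V) → M`, with coefficients in which `2 = 0`. -/

/-- The sum of the values of `φ` over all cells obtained from a given one by erasing a vertex
from one of the factors. -/
def boundarySum {V M : Type*} [DecidableEq V] [AddCommMonoid M] :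
    (List (Finset V) → M) → List (Finset V) → M
  | _, [] => 0
  | φ, Y :: X => ∑ v ∈ Y, φ (Y.erase v :: X) + boundarySum (fun Z => φ (Y :: Z)) X

/-- The sum of the values of `φ` over the cells of the Alexander-Whitney diagonal of the simplex
`S` in its `n`-fold product. -/
def diagonalSum {V M : Type*} [LinearOrder V] [AddCommMonoid M] :
    ℕ → Finset V → (List (Finset V) → M) → M
  | 0, S, φ => if S.card = 1 then φ [] else 0
  | n + 1, S, φ => ∑ s ∈ S, diagonalSum n {v ∈ S | s ≤ v} fun X => φ ({v ∈ S | v ≤ s} :: X)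

section BoundarySum

variable {V M : Type*} [DecidableEq V]

theorem boundarySum_map [AddCommMonoid M] {N : Type*} [AddCommMonoid N] (L : M →+ N)
    (φ : List (Finset V) → M) (X : List (Finset V)) :
    boundarySum (fun Z => L (φ Z)) X = L (boundarySum φ X) := by
  induction X generalizing φ with
  | nil => simp [boundarySum]
  | cons Y X ih => simp [boundarySum, ih fun Z => φ (Y :: Z)]

theorem boundarySum_sum [AddCommMonoid M] {ι : Type*} (s : Finset ι)
    (φ : ι → List (Finset V) → M) (X : List (Finset V)) :
    boundarySum (fun Z => ∑ i ∈ s, φ i Z) X = ∑ i ∈ s, boundarySum (φ i) X := by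
  induction X generalizing φ with
  | nil => simp [boundarySum]
  | cons Y X ih =>
    simp only [boundarySum, ih fun i Z => φ i (Y :: Z), Finset.sum_add_distrib]
    rw [Finset.sum_comm]

theorem boundarySum_add [AddCommMonoid M] (φ ψ : List (Finset V) → M) (X : List (Finset V)) :
    boundarySum (fun Z => φ Z + ψ Z) X = boundarySum φ X + boundarySum ψ X := by
  induction X generalizing φ ψ with
  | nil => simp [boundarySum]
  | cons Y X ih =>
    simp only [boundarySum, ih (fun Z => φ (Y :: Z)) fun Z => ψ (Y :: Z), Finset.sum_add_distrib]
    abel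

theorem exists_set_ne_zero_of_boundarySum_ne_zero [AddCommMonoid M] {φ : List (Finset V) → M}
    {X : List (Finset V)} (h : boundarySum φ X ≠ 0) :
    ∃ i v, v ∈ X.getD i ∅ ∧ φ (X.set i ((X.getD i ∅).erase v)) ≠ 0 := by
  induction X generalizing φ with
  | nil => simp [boundarySum] at h
  | cons Y X ih =>
    by_cases h0 : ∑ v ∈ Y, φ (Y.erase v :: X) = 0
    · rw [boundarySum, h0, zero_add] at h
      obtain ⟨i, v, hv, hφ⟩ := ih h
      exact ⟨i + 1, v, by simpa using hv, by simpa using hφ⟩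
    · obtain ⟨v, hv, hφ⟩ := Finset.exists_ne_zero_of_sum_ne_zero h0
      exact ⟨0, v, by simpa using hv, by simpa using hφ⟩

theorem sum_sum_erase_eq_zero [AddCommGroup M] [Module (ZMod 2) M] (Y : Finset V)
    (F : V → V → M) (hF : ∀ v w, F v w = F w v) : ∑ v ∈ Y, ∑ w ∈ Y.erase v, F v w = 0 := by
  rw [Finset.sum_sigma']
  refine Finset.sum_involution (fun a _ => ⟨a.2, a.1⟩) ?_ ?_ ?_ ?_
  · rintro ⟨v, w⟩ -
    simp only [hF w v]
    exact ZModModule.add_self _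
  · rintro ⟨v, w⟩ h - h'
    simp only [Finset.mem_sigma, Finset.mem_erase] at h
    exact h.2.1 (congrArg Sigma.fst h')
  · rintro ⟨v, w⟩ h
    simp only [Finset.mem_sigma, Finset.mem_erase] at h ⊢
    exact ⟨h.2.2, h.2.1.symm, h.1⟩
  · rintro ⟨v, w⟩ -
    rfl

theorem boundarySum_boundarySum [AddCommGroup M] [Module (ZMod 2) M]
    (φ : List (Finset V) → M) (X : List (Finset V)) : boundarySum (boundarySum φ) X = 0 := by
  induction X generalizing φ with
  | nil => rfl
  | cons Y X ih =>
    have h : ∑ v ∈ Y, ∑ w ∈ Y.erase v, φ ((Y.erase v).erase w :: X) = 0 :=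
      sum_sum_erase_eq_zero Y (fun v w => φ ((Y.erase v).erase w :: X)) fun v w => by
        rw [Finset.erase_right_comm]
    simp only [boundarySum, boundarySum_add, boundarySum_sum, Finset.sum_add_distrib, h,
      ih fun Z => φ (Y :: Z), zero_add, add_zero]
    exact ZModModule.add_self _

theorem boundarySum_indicator_card_eq_one [AddCommGroup M] [Module (ZMod 2) M] (m : M)
    (X : List (Finset V)) :
    boundarySum (fun Z => if ∀ Y ∈ Z, Y.card = 1 then m else 0) X = 0 := by
  induction X with
  | nil => rfl
  | cons Y X ih =>
    have h : ∑ v ∈ Y, (if ∀ Z ∈ Y.erase v :: X, Z.card = 1 then m else 0) = 0 := by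
      have h' : ∀ v ∈ Y, (if ∀ Z ∈ Y.erase v :: X, Z.card = 1 then m else 0) =
          if Y.card = 2 ∧ ∀ Z ∈ X, Z.card = 1 then m else 0 := fun v hv => by
        have := Finset.card_pos.2 ⟨v, hv⟩
        simp only [List.forall_mem_cons, Finset.card_erase_of_mem hv]
        congr 2
        exact propext (by omega)
      rw [Finset.sum_congr rfl h', Finset.sum_const]
      split_ifs with h2
      · rw [h2.1, two_nsmul, ZModModule.add_self]
      · simp
    rw [boundarySum, h, zero_add]
    by_cases hY : Y.card = 1
    · simpa [hY] using ih
    · have := boundarySum_map (0 : M →+ M) (fun _ => m) X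
      simpa [hY] using this

end BoundarySum

section DiagonalSum

variable {V M : Type*} [LinearOrder V]

theorem diagonalSum_map [AddCommMonoid M] {N : Type*} [AddCommMonoid N] (L : M →+ N) (n : ℕ)
    (S : Finset V) (φ : List (Finset V) → M) :
    diagonalSum n S (fun Z => L (φ Z)) = L (diagonalSum n S φ) := by
  induction n generalizing S φ with
  | zero => simp [diagonalSum, apply_ite L]
  | succ n ih => simp [diagonalSum, ih _ fun X => φ (_ :: X)]

theorem diagonalSum_sum [AddCommMonoid M] {ι : Type*} (s : Finset ι) (n : ℕ) (S : Finset V)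
    (φ : ι → List (Finset V) → M) :
    diagonalSum n S (fun Z => ∑ i ∈ s, φ i Z) = ∑ i ∈ s, diagonalSum n S (φ i) := by
  induction n generalizing S φ with
  | zero => by_cases h : S.card = 1 <;> simp [diagonalSum, h]
  | succ n ih =>
    simp only [diagonalSum, ih _ fun i X => φ i (_ :: X)]
    rw [Finset.sum_comm]

theorem diagonalSum_add [AddCommMonoid M] (n : ℕ) (S : Finset V) (φ ψ : List (Finset V) → M) :
    diagonalSum n S (fun Z => φ Z + ψ Z) = diagonalSum n S φ + diagonalSum n S ψ := by
  induction n generalizing S φ ψ with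
  | zero => by_cases h : S.card = 1 <;> simp [diagonalSum, h]
  | succ n ih =>
    simp only [diagonalSum, ih _ (fun X => φ (_ :: X)) fun X => ψ (_ :: X),
      Finset.sum_add_distrib]

theorem exists_ne_zero_of_diagonalSum_ne_zero [AddCommMonoid M] {n : ℕ} {S : Finset V}
    {φ : List (Finset V) → M} (h : diagonalSum n S φ ≠ 0) :
    ∃ X : List (Finset V), X.length = n ∧ (∀ Y ∈ X, Y ⊆ S) ∧ φ X ≠ 0 := by
  induction n generalizing S φ with
  | zero =>
    refine ⟨[], rfl, by simp, fun h0 => h ?_⟩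
    simp [diagonalSum, h0]
  | succ n ih =>
    obtain ⟨s, -, hs⟩ := Finset.exists_ne_zero_of_sum_ne_zero h
    obtain ⟨X, hX, hXS, hφ⟩ := ih hs
    refine ⟨_ :: X, by simp [hX], ?_, hφ⟩
    simp only [List.forall_mem_cons, Finset.filter_subset, true_and]
    exact fun Y hY => (hXS Y hY).trans (Finset.filter_subset _ _)

theorem diagonalSum_empty [AddCommMonoid M] (n : ℕ) (φ : List (Finset V) → M) :
    diagonalSum n ∅ φ = 0 := by
  cases n <;> simp [diagonalSum]

theorem diagonalSum_singleton [AddCommMonoid M] (n : ℕ) (v : V) (φ : List (Finset V) → M) :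
    diagonalSum n {v} φ = φ (List.replicate n {v}) := by
  induction n generalizing φ with
  | zero => simp [diagonalSum]
  | succ n ih => simp [diagonalSum, Finset.filter_singleton, ih, List.replicate_succ]

theorem sum_cuts_eq [AddCommGroup M] [Module (ZMod 2) M] (S : Finset V)
    (G : Finset V → Finset V → M) :
    ∑ s ∈ S, (G {v ∈ S | v < s} {v ∈ S | s ≤ v} + G {v ∈ S | v ≤ s} {v ∈ S | s < v}) =
      G ∅ S + G S ∅ := by
  induction S using Finset.induction_on_max generalizing G with
  | empty => simp [ZModModule.add_self]
  | insert m S hm ih =>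
    have hmS : m ∉ S := fun h => lt_irrefl _ (hm m h)
    have h1 : ∀ s ∈ S, G {v ∈ insert m S | v < s} {v ∈ insert m S | s ≤ v} +
        G {v ∈ insert m S | v ≤ s} {v ∈ insert m S | s < v} =
        G {v ∈ S | v < s} (insert m {v ∈ S | s ≤ v}) +
        G {v ∈ S | v ≤ s} (insert m {v ∈ S | s < v}) := fun s hs => by
      have := hm s hs
      simp [Finset.filter_insert, this, this.le, this.not_gt, this.not_ge]
    have h2 : {v ∈ S | v < m} = S := Finset.filter_true_of_mem hm
    have h3 : {v ∈ S | v ≤ m} = S := Finset.filter_true_of_mem fun v hv => (hm v hv).le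
    have h4 : {v ∈ S | m ≤ v} = ∅ := Finset.filter_false_of_mem fun v hv => (hm v hv).not_ge
    have h5 : {v ∈ S | m < v} = ∅ := Finset.filter_false_of_mem fun v hv => (hm v hv).not_gt
    rw [Finset.sum_insert hmS, Finset.sum_congr rfl h1, ih fun P Q => G P (insert m Q)]
    simp only [Finset.filter_insert, lt_irrefl, le_refl, if_true, if_false, h2, h3, h4, h5,
      insert_empty_eq]
    rw [add_comm (G S {m}), add_add_add_comm, ZModModule.add_self, add_zero, add_comm]

/-- The Alexander-Whitney diagonal is a chain map. -/
theorem diagonalSum_boundarySum [AddCommGroup M] [Module (ZMod 2) M] (n : ℕ) (S : Finset V)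
    (φ : List (Finset V) → M) (hφ : ∀ X, ∅ ∈ X → φ X = 0) :
    diagonalSum n S (boundarySum φ) = ∑ v ∈ S, diagonalSum n (S.erase v) φ := by
  induction n generalizing S φ with
  | zero =>
    have h : ∀ v ∈ S, diagonalSum 0 (S.erase v) φ = if S.card = 2 then φ [] else 0 :=
      fun v hv => by
        have := Finset.card_pos.2 ⟨v, hv⟩
        rw [diagonalSum, Finset.card_erase_of_mem hv]
        congr 1
        exact propext (by omega)
    rw [Finset.sum_congr rfl h, Finset.sum_const]
    split_ifs with h2
    · rw [h2, two_nsmul, ZModModule.add_self]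
      simp [diagonalSum, h2]
    · simp [diagonalSum, boundarySum]
  | succ n ih =>
    set G : Finset V → Finset V → M := fun P Q => diagonalSum n Q fun X => φ (P :: X) with hG
    have hstep : ∀ s ∈ S, (diagonalSum n {v ∈ S | s ≤ v} fun X =>
        boundarySum φ ({v ∈ S | v ≤ s} :: X)) =
        (G {v ∈ S | v < s} {v ∈ S | s ≤ v} + G {v ∈ S | v ≤ s} {v ∈ S | s < v}) +
        ∑ v ∈ S.erase s, G {w ∈ S.erase v | w ≤ s} {w ∈ S.erase v | s ≤ w} := fun s hs => by
      simp only [boundarySum, diagonalSum_add, diagonalSum_sum]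
      rw [ih _ (fun Z => φ ({v ∈ S | v ≤ s} :: Z)) fun X hX => hφ _ (List.mem_cons_of_mem _ hX)]
      change ∑ v ∈ {v ∈ S | v ≤ s}, G ({v ∈ S | v ≤ s}.erase v) {v ∈ S | s ≤ v} +
        ∑ v ∈ {v ∈ S | s ≤ v}, G {v ∈ S | v ≤ s} ({v ∈ S | s ≤ v}.erase v) = _
      have e1 : {v ∈ S | v ≤ s}.erase s = {v ∈ S | v < s} := by
        ext w; simp only [Finset.mem_erase, Finset.mem_filter, lt_iff_le_and_ne]; tauto
      have e2 : {v ∈ S | s ≤ v}.erase s = {v ∈ S | s < v} := by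
        ext w; simp only [Finset.mem_erase, Finset.mem_filter, lt_iff_le_and_ne, ne_comm]; tauto
      have e3 : S.erase s = {v ∈ S | v < s} ∪ {v ∈ S | s < v} := by
        ext w
        simp only [Finset.mem_erase, Finset.mem_union, Finset.mem_filter, ne_iff_lt_or_gt]
        tauto
      have e4 : Disjoint {v ∈ S | v < s} {v ∈ S | s < v} :=
        Finset.disjoint_filter.2 fun w _ h h' => lt_asymm h h'
      rw [← Finset.add_sum_erase {v ∈ S | v ≤ s} _ (Finset.mem_filter.2 ⟨hs, le_refl s⟩),
        ← Finset.add_sum_erase {v ∈ S | s ≤ v} _ (Finset.mem_filter.2 ⟨hs, le_refl s⟩), e1, e2,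
        e3, Finset.sum_union e4, add_add_add_comm]
      congr 2
      · refine Finset.sum_congr rfl fun v hv => ?_
        have hv := (Finset.mem_filter.1 hv).2
        congr 1
        · rw [Finset.filter_erase]
        · rw [Finset.filter_erase, Finset.erase_eq_of_notMem]
          simp [hv]
      · refine Finset.sum_congr rfl fun v hv => ?_
        have hv := (Finset.mem_filter.1 hv).2
        congr 1
        · rw [Finset.filter_erase, Finset.erase_eq_of_notMem]
          simp [hv]
        · rw [Finset.filter_erase]
    have h0 : G ∅ S = 0 := by
      have := diagonalSum_map (0 : M →+ M) n S fun X => φ (∅ :: X)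
      simpa [hG, hφ] using this
    have h0' : G S ∅ = 0 := diagonalSum_empty _ _
    rw [diagonalSum, Finset.sum_congr rfl hstep, Finset.sum_add_distrib, sum_cuts_eq, h0, h0',
      add_zero, zero_add]
    refine Finset.sum_comm' fun v w => ?_
    simp only [Finset.mem_erase]
    tauto

end DiagonalSum

/-! ### Colorings of cells -/

section Coloring

variable {V : Type*}

/-- The cone with apex `v` over a mod 2 chain of the full simplex on `V`. -/
def simplexCone [DecidableEq V] (v : V) (c : Finset V → ZMod 2) : Finset V → ZMod 2 :=
  fun T => if v ∈ T then c (T.erase v) else 0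

/-- The boundary of a mod 2 chain of the full simplex on `V`. -/
def simplexBoundary [DecidableEq V] [Fintype V] :
    (Finset V → ZMod 2) →+ (Finset V → ZMod 2) where
  toFun c T := ∑ v ∈ Tᶜ, c (insert v T)
  map_zero' := by ext; simp
  map_add' c c' := by ext; simp [Finset.sum_add_distrib]

theorem simplexBoundary_simplexCone [DecidableEq V] [Fintype V] (v : V)
    (c : Finset V → ZMod 2) (hc : simplexBoundary c = 0) :
    simplexBoundary (simplexCone v c) = c := by
  ext T
  change ∑ w ∈ Tᶜ, (if v ∈ insert w T then c ((insert w T).erase v) else 0) = c T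
  by_cases hv : v ∈ T
  · have h : ∑ w ∈ (T.erase v)ᶜ, c (insert w (T.erase v)) = 0 := congrFun hc (T.erase v)
    rw [Finset.compl_erase, Finset.sum_insert (by simpa using hv), Finset.insert_erase hv] at h
    rw [CharTwo.add_eq_zero.1 h]
    refine Finset.sum_congr rfl fun w hw => ?_
    have hwv : w ≠ v := by rintro rfl; exact Finset.mem_compl.1 hw hv
    rw [if_pos (Finset.mem_insert_of_mem hv), Finset.erase_insert_of_ne hwv]
  · rw [Finset.sum_eq_single_of_mem v (Finset.mem_compl.2 hv)]
    · simp [hv]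
    · intro w _ hwv
      simp [hv, hwv.symm]

theorem simplexBoundary_single_singleton [DecidableEq V] [Fintype V] (v : V) :
    simplexBoundary (Pi.single {v} 1 : Finset V → ZMod 2) = Pi.single ∅ 1 := by
  have hcone : (Pi.single {v} 1 : Finset V → ZMod 2) = simplexCone v (Pi.single ∅ 1) := by
    ext T
    by_cases hv : v ∈ T
    · simp only [simplexCone, hv, if_true, Pi.single_apply, Finset.erase_eq_empty_iff]
      congr 1
      exact propext ⟨Or.inr, fun h => h.resolve_left (Finset.ne_empty_of_mem hv)⟩
    · have : T ≠ {v} := by rintro rfl; simp at hv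
      simp [simplexCone, hv, this]
  rw [hcone]
  refine simplexBoundary_simplexCone v _ ?_
  ext T
  exact Finset.sum_eq_zero fun w _ => Pi.single_eq_of_ne (Finset.insert_ne_empty w T) 1

/-- The chain of the full simplex on `V` which counts, mod 2, the color sets of the rainbow flags
of cells of dimensions `0, …, d` ending at a given cell. -/
def flagChain [DecidableEq V] (color : List (Finset V) → V) :
    ℕ → List (Finset V) → Finset V → ZMod 2
  | 0, X => if ∀ Y ∈ X, Y.card = 1 then Pi.single {color X} 1 else 0
  | d + 1, X => simplexCone (color X) (boundarySum (flagChain color d) X)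

theorem flagChain_eq_zero_of_empty_mem [DecidableEq V] (color : List (Finset V) → V) (d : ℕ)
    {X : List (Finset V)} (hX : ∅ ∈ X) : flagChain color d X = 0 := by
  induction d generalizing X with
  | zero => exact if_neg fun h => by simpa using h ∅ hX
  | succ d ih =>
    have h : boundarySum (flagChain color d) X = 0 := by
      by_contra h
      obtain ⟨i, v, hv, hne⟩ := exists_set_ne_zero_of_boundarySum_ne_zero h
      refine hne (ih ?_)
      obtain ⟨j, hj, hXj⟩ := List.mem_iff_getElem.1 hX
      have hij : i ≠ j := by
        rintro rfl
        rw [List.getD_eq_getElem _ _ hj, hXj] at hv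
        exact Finset.notMem_empty v hv
      exact List.mem_iff_getElem.2 ⟨j, by simpa using hj, by simp [hij, hXj]⟩
    ext T
    simp [flagChain, simplexCone, h]

theorem simplexBoundary_flagChain_succ [DecidableEq V] [Fintype V]
    (color : List (Finset V) → V) (d : ℕ) (X : List (Finset V)) :
    simplexBoundary (flagChain color (d + 1) X) = boundarySum (flagChain color d) X := by
  have key : simplexBoundary (boundarySum (flagChain color d) X) = 0 := by
    rw [← boundarySum_map]
    cases d with
    | zero =>
      have h : ∀ Z, simplexBoundary (flagChain color 0 Z) =
          if ∀ Y ∈ Z, Y.card = 1 then Pi.single ∅ 1 else 0 := fun Z => by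
        simp only [flagChain]
        split_ifs
        · exact simplexBoundary_single_singleton _
        · simp
      simp only [h]
      convert boundarySum_indicator_card_eq_one (Pi.single ∅ 1 : Finset V → ZMod 2) X
      rfl
    | succ d =>
      simp only [simplexBoundary_flagChain_succ color d]
      exact boundarySum_boundarySum (flagChain color d) X
  exact simplexBoundary_simplexCone (color X) _ key

/-- A Sperner lemma: if the chains of rainbow flags are supported on the colors which occur in the
last cell of the flag, then the diagonal of a `d`-simplex carries an odd number of rainbow flags
with the colors of this simplex. -/
theorem diagonalSum_flagChain_apply_self [LinearOrder V] [Fintype V]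
    (color : List (Finset V) → V) {n k : ℕ}
    (hcolor : ∀ d ≤ k, ∀ (X : List (Finset V)) (S T : Finset V), X.length = n →
      (∀ Y ∈ X, Y ⊆ S) → flagChain color d X T ≠ 0 → T ⊆ S)
    {d : ℕ} (hd : d ≤ k) {S : Finset V} (hS : S.card = d + 1) :
    diagonalSum n S (flagChain color d) S = 1 := by
  have hsupp : ∀ d ≤ k, ∀ S T : Finset V, ¬ T ⊆ S →
      diagonalSum n S (flagChain color d) T = 0 := fun d hd S T hTS => by
    by_contra h
    have h' : diagonalSum n S (fun X => flagChain color d X T) ≠ 0 := fun h0 =>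
      h ((diagonalSum_map (Pi.evalAddMonoidHom (fun _ => ZMod 2) T) n S _).symm.trans h0)
    obtain ⟨X, hX, hXS, hne⟩ := exists_ne_zero_of_diagonalSum_ne_zero h'
    exact hTS (hcolor d hd X S T hX hXS hne)
  induction d generalizing S with
  | zero =>
    obtain ⟨v, rfl⟩ := Finset.card_eq_one.1 hS
    have hv : ∀ Y ∈ List.replicate n ({v} : Finset V), Y.card = 1 := fun Y hY => by
      simp [List.eq_of_mem_replicate hY]
    have hc := hcolor 0 hd (List.replicate n {v}) {v} {color (List.replicate n {v})} (by simp)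
      (fun Y hY => (List.eq_of_mem_replicate hY).subset) (by simp only [flagChain, if_pos hv]; simp)
    rw [Finset.singleton_subset_singleton] at hc
    rw [diagonalSum_singleton]
    simp only [flagChain, if_pos hv, hc]
    simp
  | succ d ih =>
    obtain ⟨v, hv⟩ : S.Nonempty := Finset.card_pos.1 (by omega)
    have h : simplexBoundary (diagonalSum n S (flagChain color (d + 1))) =
        ∑ w ∈ S, diagonalSum n (S.erase w) (flagChain color d) := by
      rw [← diagonalSum_map, ← diagonalSum_boundarySum _ _ _ fun X hX =>
        flagChain_eq_zero_of_empty_mem color d hX]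
      simp only [simplexBoundary_flagChain_succ]
    have h1 : ∑ w ∈ (S.erase v)ᶜ, diagonalSum n S (flagChain color (d + 1))
        (insert w (S.erase v)) = diagonalSum n S (flagChain color (d + 1)) S := by
      rw [Finset.sum_eq_single_of_mem v (by simp), Finset.insert_erase hv]
      intro w hw hwv
      refine hsupp _ hd _ _ fun hsub => ?_
      simp only [Finset.mem_compl, Finset.mem_erase, not_and] at hw
      exact hw hwv (hsub (Finset.mem_insert_self _ _))
    have h2 : (∑ w ∈ S, diagonalSum n (S.erase w) (flagChain color d)) (S.erase v) = 1 := by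
      rw [Finset.sum_apply, Finset.sum_eq_single_of_mem v hv]
      · exact ih (by omega) (by rw [Finset.card_erase_of_mem hv, hS]; rfl)
      · intro w hw hwv
        exact hsupp _ (by omega) _ _ fun hsub =>
          Finset.notMem_erase w S (hsub (Finset.mem_erase.2 ⟨hwv, hw⟩))
    rw [← h1, ← h2]
    exact congrFun h (S.erase v)

end Coloring

/-! ### Decisions with few processes varying -/

/-- If the color of every cell with at most `k` varying processes is decided by some process on
every assignment in the cell, then all colors of a rainbow flag are decided on one assignment. -/
theorem exists_assignment_of_flagChain_ne_zero {V : Type*} [DecidableEq V] {n k : ℕ}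
    (decision : Fin n → (Fin n → V) → V) (color : List (Finset V) → V)
    (hcolor : ∀ (X : List (Finset V)) (D : Finset (Fin n)), D.card ≤ k →
      (∀ i ∉ D, (X.getD i ∅).card = 1) → ∀ x : Fin n → V, (∀ i : Fin n, x i ∈ X.getD i ∅) →
      ∃ i, decision i x = color X)
    {d : ℕ} (hd : d ≤ k) {X : List (Finset V)} {T : Finset V} (hX : X.length = n)
    (hT : flagChain color d X T ≠ 0) :
    (∃ D : Finset (Fin n), D.card ≤ d ∧ ∀ i ∉ D, (X.getD i ∅).card = 1) ∧
      ∃ x : Fin n → V, (∀ i : Fin n, x i ∈ X.getD i ∅) ∧ ∀ t ∈ T, ∃ i, decision i x = t := by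
  induction d generalizing X T with
  | zero =>
    simp only [flagChain] at hT
    split_ifs at hT with h1
    · have hrow : ∀ i : Fin n, (X.getD i ∅).card = 1 := fun i => by
        rw [List.getD_eq_getElem _ _ (by omega)]
        exact h1 _ (List.getElem_mem _)
      have hne : ∀ i : Fin n, ∃ v, v ∈ X.getD i ∅ := fun i =>
        Finset.card_pos.1 (by rw [hrow i]; exact one_pos)
      choose x hx using hne
      refine ⟨⟨∅, by simp, fun i _ => hrow i⟩, x, hx, ?_⟩
      have hTX : T = {color X} := by
        by_contra h
        exact hT (by simp [h])
      intro t ht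
      rw [hTX, Finset.mem_singleton] at ht
      rw [ht]
      exact hcolor X ∅ (by simp) (fun i _ => hrow i) x hx
    · simp at hT
  | succ d ih =>
    have hT' : color X ∈ T ∧ boundarySum (flagChain color d) X (T.erase (color X)) ≠ 0 := by
      simp only [flagChain, simplexCone] at hT
      split_ifs at hT with h
      · exact ⟨h, hT⟩
      · exact absurd rfl hT
    obtain ⟨hcT, hne⟩ := hT'
    have hne' : boundarySum (fun Z => flagChain color d Z (T.erase (color X))) X ≠ 0 := fun h0 =>
      hne ((boundarySum_map (Pi.evalAddMonoidHom (fun _ => ZMod 2) (T.erase (color X)))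
        (flagChain color d) X).symm.trans h0)
    obtain ⟨j, v, hv, hφ⟩ := exists_set_ne_zero_of_boundarySum_ne_zero hne'
    have hj : j < n := by
      by_contra h
      rw [List.getD_eq_default X ∅ (by omega : X.length ≤ j)] at hv
      exact Finset.notMem_empty v hv
    have hset : ∀ i : Fin n, (X.set j ((X.getD j ∅).erase v)).getD i ∅ =
        if j = i then (X.getD j ∅).erase v else X.getD i ∅ := fun i => by
      rw [List.getD_eq_getElem _ _ (by simp [hX]), List.getElem_set,
        List.getD_eq_getElem X ∅ (by omega : (i : ℕ) < X.length)]
    obtain ⟨⟨D, hD, hrow⟩, x, hx, hxT⟩ := ih (by omega) (by simpa using hX) hφ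
    have hrow' : ∀ i ∉ insert ⟨j, hj⟩ D, (X.getD i ∅).card = 1 := fun i hi => by
      rw [Finset.mem_insert, not_or] at hi
      have := hrow i hi.2
      rwa [hset, if_neg fun h => hi.1 (Fin.ext h.symm)] at this
    have hD' : (insert ⟨j, hj⟩ D).card ≤ d + 1 :=
      (Finset.card_insert_le _ _).trans (Nat.succ_le_succ hD)
    have hx' : ∀ i : Fin n, x i ∈ X.getD i ∅ := fun i => by
      have := hx i
      rw [hset] at this
      split_ifs at this with h
      · rw [← h]
        exact Finset.mem_of_mem_erase this
      · exact this
    refine ⟨⟨_, hD', hrow'⟩, x, hx', fun t ht => ?_⟩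
    by_cases htc : t = color X
    · rw [htc]
      exact hcolor X _ (hD'.trans hd) hrow' x hx'
    · exact hxT t (Finset.mem_erase.2 ⟨htc, ht⟩)

/-- If every set of at most `k` processes is unheard by some process, then processes deciding
on one of the inputs `0, …, k` reach all `k + 1` decisions on some input assignment. -/
theorem exists_forall_decided {n k : ℕ} (E : Fin n → Fin n → Prop)
    (hdom : ∀ D : Finset (Fin n), IsDominating E D → k < D.card)
    (decision : Fin n → (Fin n → Fin (k + 1)) → Fin (k + 1))
    (hview : ∀ i x y, (∀ j, j = i ∨ E j i → x j = y j) → decision i x = decision i y)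
    (hvalid : ∀ i x, decision i x ∈ Set.range x) :
    ∃ x, ∀ t, ∃ i, decision i x = t := by
  classical
  have hcolor : ∀ X : List (Finset (Fin (k + 1))), ∃ c, ∀ D : Finset (Fin n), D.card ≤ k →
      (∀ i ∉ D, (X.getD i ∅).card = 1) → ∀ x : Fin n → Fin (k + 1),
      (∀ i : Fin n, x i ∈ X.getD i ∅) → ∃ i, decision i x = c := fun X => by
    by_cases h : ∃ D : Finset (Fin n), D.card ≤ k ∧ (∀ i ∉ D, (X.getD i ∅).card = 1) ∧
        ∃ x : Fin n → Fin (k + 1), ∀ i : Fin n, x i ∈ X.getD i ∅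
    · obtain ⟨D, hD, hrow, x, hx⟩ := h
      set D' : Finset (Fin n) := {i | (X.getD i ∅).card ≠ 1} with hD'
      have hsub : D' ⊆ D := fun i hi => by
        by_contra hiD
        exact (Finset.mem_filter.1 hi).2 (hrow i hiD)
      have hnot : ¬ IsDominating E D' := fun h' =>
        absurd (hdom D' h') (not_lt.2 ((Finset.card_le_card hsub).trans hD))
      simp only [IsDominating, not_forall, not_or, not_exists, not_and] at hnot
      obtain ⟨q, hqD, hqE⟩ := hnot
      refine ⟨decision q x, fun _ _ _ y hy => ⟨q, hview q y x fun j hj => ?_⟩⟩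
      have hjD : j ∉ D' := by
        rcases hj with rfl | hj
        · exact hqD
        · exact fun hjD => hqE j hjD hj
      have hcard : (X.getD j ∅).card = 1 := by simpa [hD'] using hjD
      exact Finset.card_le_one.1 hcard.le _ (hy j) _ (hx j)
    · exact ⟨0, fun D hD hrow x hx => absurd ⟨D, hD, hrow, x, hx⟩ h⟩
  choose color hcolor using hcolor
  have hodd : diagonalSum n Finset.univ (flagChain color k) Finset.univ = 1 := by
    refine diagonalSum_flagChain_apply_self color (k := k) ?_ le_rfl (by simp)
    intro d hd X S T hX hXS hT t ht
    obtain ⟨-, x, hx, hxT⟩ :=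
      exists_assignment_of_flagChain_ne_zero decision color hcolor hd hX hT
    obtain ⟨i, rfl⟩ := hxT t ht
    obtain ⟨j, hj⟩ := hvalid i x
    rw [← hj]
    have hxj := hx j
    rw [List.getD_eq_getElem _ _ (by omega)] at hxj
    exact hXS _ (List.getElem_mem _) hxj
  have hne : diagonalSum n Finset.univ (fun X => flagChain color k X Finset.univ) ≠ 0 := by
    have := diagonalSum_map (Pi.evalAddMonoidHom (fun _ => ZMod 2) Finset.univ) n Finset.univ
      (flagChain color k)
    simp only [Pi.evalAddMonoidHom_apply] at this
    rw [this, hodd]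
    exact one_ne_zero
  obtain ⟨X, hX, -, hXne⟩ := exists_ne_zero_of_diagonalSum_ne_zero hne
  obtain ⟨-, x, -, hx⟩ :=
    exists_assignment_of_flagChain_ne_zero decision color hcolor le_rfl hX hXne
  exact ⟨x, fun t => hx t (Finset.mem_univ t)⟩

/-- **Theorem (impossibility of k-set agreement).** If the domination number of the
information-flow digraph `E` is strictly greater than `k`, then no decision function solves
`k`-set agreement on `E` (even with only `k + 1` distinct input values available). -/
theorem setAgreement_impossible_of_domination_gt {n k : ℕ} (hn : 1 ≤ n) (hk : 1 ≤ k)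
    (E : Fin n → Fin n → Prop) {I : Type*}
    (hI : ∃ g : Fin (k + 1) → I, Function.Injective g)
    (hdom : ∀ D : Finset (Fin n), IsDominating E D → k < D.card) :
    ∀ f : (i : Fin n) → (Fin n → Option I) → I, ¬ SolvesSetAgreement k E f := by
  rintro f hf
  obtain ⟨g, hg⟩ := hI
  have hex : ∀ (i : Fin n) (x : Fin n → Fin (k + 1)), ∃ j,
      g (x j) = f i (view E (g ∘ x) i) := fun i x => (hf (g ∘ x)).1 i
  choose p hp using hex
  obtain ⟨x, hx⟩ := exists_forall_decided E hdom (fun i x => x (p i x))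
    (fun i x y hxy => hg (by
      rw [hp, hp]
      congr 1
      funext j
      unfold view
      split_ifs with h
      · simp [hxy j h]
      · rfl))
    fun i x => ⟨p i x, rfl⟩
  have hsub : Set.range g ⊆ Set.range fun i => f i (view E (g ∘ x) i) := by
    rintro _ ⟨t, rfl⟩
    obtain ⟨i, rfl⟩ := hx t
    exact ⟨i, (hp i x).symm⟩
  have h1 := Set.ncard_le_ncard hsub (Set.finite_range _)
  have h2 : (Set.range g).ncard = k + 1 := by
    rw [Set.ncard_range_of_injective hg, Nat.card_fin]
  have h3 := (hf (g ∘ x)).2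
  omega
end

section
/- Let n ≥ 1 and k ≥ 1, and let E be a digraph on Fin n that has a dominating set of cardinality at most k. Then for every nonempty type I of input values there exists a decision function f : (i : Fin n) → (Fin n → Option I) → I that solves k-set agreement on E. (Each process can output the input value of some member of the dominating set that it hears from; at most k values are decided in total.) -/
/-- A process that is `j` or hears from `j` sees the input of `j` in its view. -/
theorem view_eq_some {V I : Type*} {E : V → V → Prop} {i j : V} (h : j = i ∨ E j i) (x : V → I) :
    view E x i j = some (x j) :=
  if_pos h

/-- A dominating set admits a choice of a dominator for every vertex. -/
theorem IsDominating.exists_dominator {n : ℕ} {E : Fin n → Fin n → Prop} {D : Finset (Fin n)}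
    (hD : IsDominating E D) :
    ∃ d : Fin n → Fin n, ∀ v, d v ∈ D ∧ (d v = v ∨ E (d v) v) := by
  rw [← Classical.skolem (p := fun v u => u ∈ D ∧ (u = v ∨ E u v))]
  intro v
  rcases hD v with hv | ⟨u, hu, huv⟩
  · exact ⟨v, hv, Or.inl rfl⟩
  · exact ⟨u, hu, Or.inr huv⟩

/-- **Theorem (solvability of k-set agreement).** If the information-flow digraph `E` has a
dominating set of cardinality at most `k`, then `k`-set agreement is solvable on `E`, for
every nonempty type of input values. -/
theorem setAgreement_solvable_of_domination_le {n k : ℕ} (hn : 1 ≤ n) (hk : 1 ≤ k)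
    (E : Fin n → Fin n → Prop)
    (hdom : ∃ D : Finset (Fin n), IsDominating E D ∧ D.card ≤ k)
    (I : Type*) [Nonempty I] :
    ∃ f : (i : Fin n) → (Fin n → Option I) → I, SolvesSetAgreement k E f := by
  obtain ⟨D, hD, hcard⟩ := hdom
  obtain ⟨d, hd⟩ := hD.exists_dominator
  refine ⟨fun i w => (w (d i)).getD (Classical.arbitrary I), fun x => ?_⟩
  simp only [view_eq_some (hd _).2, Option.getD_some]
  refine ⟨fun i => ⟨d i, rfl⟩, ?_⟩
  have hsub : (Set.range fun i => x (d i)) ⊆ x '' (D : Set (Fin n)) := by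
    rintro _ ⟨i, rfl⟩
    exact ⟨d i, (hd i).1, rfl⟩
  calc (Set.range fun i => x (d i)).ncard
      ≤ (x '' (D : Set (Fin n))).ncard := Set.ncard_le_ncard hsub (D.finite_toSet.image x)
    _ ≤ (D : Set (Fin n)).ncard := Set.ncard_image_le D.finite_toSet
    _ = D.card := Set.ncard_coe_finset D
    _ ≤ k := hcard
end

section
/- Let n ≥ 1 and let E be a digraph on Fin n. There exists a decision function f : (i : Fin n) → (Fin n → Option Bool) → Bool solving binary consensus (1-set agreement with I = Bool) on E if and only if E has a universal node, i.e., a node u such that every vertex v satisfies v = u or E u v. -/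
theorem view_update_of_not_hears {V I : Type*} [DecidableEq V] (E : V → V → Prop) (x : V → I)
    {u v : V} (huv : ¬(v = u ∨ E u v)) (b : I) :
    view E (Function.update x u b) v = view E x v := by
  funext j
  by_cases hj : j = u
  · subst hj
    simp only [view, if_neg (show ¬(j = v ∨ E j v) by rwa [eq_comm])]
  · simp only [view, Function.update_of_ne hj]

theorem apply_piecewise_eq_of_forall_update_eq {V I α : Type*} [DecidableEq V]
    (g : (V → I) → α) (hg : ∀ x u b, g (Function.update x u b) = g x) (x y : V → I)
    (s : Finset V) : g (s.piecewise x y) = g y := by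
  induction s using Finset.induction_on with
  | empty => rw [Finset.piecewise_empty]
  | insert a s _ ih => rw [Finset.piecewise_insert, hg, ih]

/-- A function on a finite product that no single-coordinate change affects is constant. -/
theorem eq_of_forall_update_eq {V I α : Type*} [Fintype V] [DecidableEq V]
    (g : (V → I) → α) (hg : ∀ x u b, g (Function.update x u b) = g x) (x y : V → I) :
    g x = g y := by
  simpa using apply_piecewise_eq_of_forall_update_eq g hg x y Finset.univ

theorem SolvesSetAgreement.decision_eq {n : ℕ} {I : Type*} {E : Fin n → Fin n → Prop}
    {f : (i : Fin n) → (Fin n → Option I) → I} (hf : SolvesSetAgreement 1 E f)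
    (x : Fin n → I) (i j : Fin n) : f i (view E x i) = f j (view E x j) :=
  (Set.ncard_le_one (Set.finite_range _)).1 (hf x).2 _ ⟨i, rfl⟩ _ ⟨j, rfl⟩

/-- **Theorem (characterization of consensus solvability).** Binary consensus (`1`-set
agreement with input values in `Bool`) is solvable on the information-flow digraph `E` if and
only if `E` has a universal node, i.e., a node dominating all other nodes. -/
theorem binaryConsensus_solvable_iff_universal_node {n : ℕ} (hn : 1 ≤ n)
    (E : Fin n → Fin n → Prop) :
    (∃ f : (i : Fin n) → (Fin n → Option Bool) → Bool, SolvesSetAgreement 1 E f) ↔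
      ∃ u : Fin n, ∀ v : Fin n, v = u ∨ E u v := by
  constructor
  · rintro ⟨f, hf⟩
    by_contra! hE
    let i : Fin n := ⟨0, hn⟩
    have hg : ∀ (x : Fin n → Bool) (u : Fin n) (b : Bool),
        f i (view E (Function.update x u b) i) = f i (view E x i) := by
      intro x u b
      obtain ⟨v, hv⟩ := hE u
      rw [hf.decision_eq _ i v, view_update_of_not_hears E x (not_or.2 hv) b, hf.decision_eq x v i]
    have hconst := eq_of_forall_update_eq (fun x => f i (view E x i)) hg
      (fun _ => true) (fun _ => false)
    obtain ⟨_, ht⟩ := (hf fun _ => true).1 i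
    obtain ⟨_, hb⟩ := (hf fun _ => false).1 i
    exact Bool.noConfusion (ht.trans (hconst.trans hb.symm))
  · rintro ⟨u, hu⟩
    have hview (x : Fin n → Bool) (i : Fin n) : (view E x i u).getD false = x u := by
      simp only [view, if_pos ((hu i).imp_left Eq.symm), Option.getD_some]
    refine ⟨fun _ w => (w u).getD false, fun x => ⟨fun i => ⟨u, (hview x i).symm⟩, ?_⟩⟩
    simp only [hview]
    rw [Set.ncard_le_one (Set.finite_range _)]
    rintro _ ⟨_, rfl⟩ _ ⟨_, rfl⟩
    rfl
end

section
/- Let n ≥ 1 and k ≥ 1, let G_1, …, G_r be a finite sequence of digraphs on Fin n, and let E_{≤r} be the information-flow digraph of the sequence (arcs given by temporal reachability within r rounds). Let I be a type having at least k+1 distinct elements. If E_{≤r} has no dominating set of cardinality at most k, then no decision function f : (i : Fin n) → (Fin n → Option I) → I solves k-set agreement on E_{≤r}. Consequently, in the dynamic network model, any algorithm solving k-set agreement against an adversary that can produce the sequence G_1, …, G_r needs strictly more than r rounds. -/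
/-- `u` temporally reaches `v` within `r` rounds of the dynamic graph sequence `Gs`:
either `u = v`, or there is a sequence of vertices `u = w 0, w 1, …, w ℓ = v` and strictly
increasing rounds `1 ≤ ts 1 < ts 2 < ⋯ < ts ℓ ≤ r` with an arc of `Gs (ts m)` from
`w (m - 1)` to `w m` for each `m`. -/
def TemporalReach {n : ℕ} (Gs : ℕ → Fin n → Fin n → Prop) (r : ℕ) (u v : Fin n) : Prop :=
  u = v ∨ ∃ (ℓ : ℕ) (w : ℕ → Fin n) (ts : ℕ → ℕ),
    1 ≤ ℓ ∧ w 0 = u ∧ w ℓ = v ∧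
    (∀ m : ℕ, 1 ≤ m → m ≤ ℓ → 1 ≤ ts m ∧ ts m ≤ r) ∧
    (∀ m : ℕ, 1 ≤ m → m + 1 ≤ ℓ → ts m < ts (m + 1)) ∧
    (∀ m : ℕ, 1 ≤ m → m ≤ ℓ → Gs (ts m) (w (m - 1)) (w m))

/-- The information-flow digraph of the first `r` rounds of the dynamic graph sequence `Gs`:
an arc from `u` to `v` iff `u ≠ v` and `u` temporally reaches `v` within `r` rounds. -/
def infoFlow {n : ℕ} (Gs : ℕ → Fin n → Fin n → Prop) (r : ℕ) : Fin n → Fin n → Prop :=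
  fun u v => u ≠ v ∧ TemporalReach Gs r u v

/-- The `i`-th cell of the flag `φ = (w, σ)` of cells of the cubical grid `[0, n] ^ m`. A grid cell
is coded by doubled coordinates: an even coordinate `2 a` is the point `a`, an odd one `2 a + 1` is
the interval `[a, a + 1]`. The flag starts at a vertex of the cube with coordinates `(w c).1`, the
vertex being on the upper side in direction `c` iff `(w c).2`, and direction `c` is opened at
step `σ c`. -/
def flagCell {m n : ℕ} (φ : (Fin m → Fin n × Bool) × Equiv.Perm (Fin m)) (i : ℕ) (c : Fin m) : ℕ :=
  if (φ.2 c : ℕ) < i then 2 * ((φ.1 c).1 : ℕ) + 1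
  else 2 * ((φ.1 c).1 : ℕ) + if (φ.1 c).2 then 2 else 0

/-- The determinant over `ZMod 2` of the incidence matrix of labels; it is the indicator of `l`
being a bijection onto `{0, …, m - 1}`. -/
def labelDet {m : ℕ} (l : Fin m → ℕ) : ZMod 2 :=
  (Matrix.of fun i v : Fin m => if l i = (v : ℕ) then (1 : ZMod 2) else 0).det

theorem injective_of_labelDet_ne_zero {m : ℕ} {l : Fin m → ℕ} (h : labelDet l ≠ 0) :
    Function.Injective l := by
  intro i j hij
  by_contra hne
  exact h (Matrix.det_zero_of_row_eq hne (by ext v; simp [hij]))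

theorem labelDet_eq_zero_of_missing {m : ℕ} {l : Fin m → ℕ} (v : Fin m) (h : ∀ i, l i ≠ v) :
    labelDet l = 0 :=
  Matrix.det_eq_zero_of_column_eq_zero v (by simp [h])

/-- Deleting one label at a time: the local parity count in Sperner's lemma. -/
theorem labelDet_eq_sum_succAbove {m : ℕ} (l : Fin (m + 1) → ℕ) (hl : ∀ i, l i ≤ m) :
    labelDet l = ∑ i : Fin (m + 1), labelDet fun a => l (i.succAbove a) := by
  have h1 : (-1 : ZMod 2) = 1 := by decide
  have key := Matrix.det_updateCol_sum
    (Matrix.of fun i v : Fin (m + 1) => if l i = (v : ℕ) then (1 : ZMod 2) else 0)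
    (Fin.last m) (fun _ => 1)
  rw [one_smul] at key
  rw [labelDet, ← key, Matrix.det_succ_column _ (Fin.last m)]
  refine Finset.sum_congr rfl fun i _ => ?_
  have hone : ∑ v : Fin (m + 1), (if l i = (v : ℕ) then (1 : ZMod 2) else 0) = 1 := by
    rw [Finset.sum_eq_single (⟨l i, Nat.lt_succ_of_le (hl i)⟩ : Fin (m + 1))]
    · simp
    · intro b _ hb
      rw [if_neg]
      rintro h
      exact hb (Fin.ext h.symm)
    · simp
  simp only [Matrix.updateCol_self, Matrix.of_apply, one_smul, h1, one_pow, one_mul, hone]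
  rw [labelDet]
  congr 1
  ext a b
  simp [Fin.castSucc_ne_last]

section Flags

variable {m n : ℕ}

theorem sum_labelDet_delete_first (L : (Fin (m + 1) → ℕ) → ℕ) :
    ∑ φ : (Fin (m + 1) → Fin n × Bool) × Equiv.Perm (Fin (m + 1)),
      labelDet (fun a : Fin (m + 1) =>
        L (flagCell φ ((0 : Fin (m + 2)).succAbove a : Fin (m + 2)))) = 0 := by
  refine Finset.sum_involution
    (fun φ _ => (Function.update φ.1 (φ.2.symm 0)
      ((φ.1 (φ.2.symm 0)).1, !(φ.1 (φ.2.symm 0)).2), φ.2)) ?_ ?_ ?_ ?_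
  · rintro ⟨w, σ⟩ -
    have : ∀ a : Fin (m + 1), flagCell (Function.update w (σ.symm 0)
        ((w (σ.symm 0)).1, !(w (σ.symm 0)).2), σ) ((0 : Fin (m + 2)).succAbove a : Fin (m + 2)) =
        flagCell (w, σ) ((0 : Fin (m + 2)).succAbove a : Fin (m + 2)) := by
      intro a
      funext c
      by_cases hc : c = σ.symm 0
      · subst hc
        simp [flagCell]
      · simp [flagCell, Function.update_of_ne hc]
    simp only [this]
    exact CharTwo.add_self_eq_zero _
  · rintro ⟨w, σ⟩ - - h
    have := congrFun (congrArg Prod.fst h) (σ.symm 0)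
    simp [Prod.ext_iff] at this
  · simp
  · rintro ⟨w, σ⟩ -
    simp

theorem sum_labelDet_delete_middle (L : (Fin (m + 1) → ℕ) → ℕ) (i : Fin m) :
    ∑ φ : (Fin (m + 1) → Fin n × Bool) × Equiv.Perm (Fin (m + 1)),
      labelDet (fun a : Fin (m + 1) =>
        L (flagCell φ (i.castSucc.succ.succAbove a : Fin (m + 2)))) = 0 := by
  refine Finset.sum_involution
    (fun φ _ => (φ.1, φ.2.trans (Equiv.swap i.castSucc i.succ))) ?_ ?_ ?_ ?_
  · rintro ⟨w, σ⟩ -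
    have : ∀ a : Fin (m + 1), flagCell (w, σ.trans (Equiv.swap i.castSucc i.succ))
        (i.castSucc.succ.succAbove a : Fin (m + 2)) =
        flagCell (w, σ) (i.castSucc.succ.succAbove a : Fin (m + 2)) := by
      intro a
      funext c
      have hne : ((i.castSucc.succ.succAbove a : Fin (m + 2)) : ℕ) ≠ i + 1 := fun h =>
        Fin.succAbove_ne i.castSucc.succ a (Fin.ext (by simpa using h))
      have hiff : ((Equiv.swap i.castSucc i.succ (σ c) : Fin (m + 1)) : ℕ) <
          (i.castSucc.succ.succAbove a : Fin (m + 2)) ↔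
          (σ c : ℕ) < (i.castSucc.succ.succAbove a : Fin (m + 2)) := by
        rw [Equiv.swap_apply_def]
        split_ifs with h1 h2
        · rw [h1]; simp only [Fin.val_succ, Fin.val_castSucc]; omega
        · rw [h2]; simp only [Fin.val_succ, Fin.val_castSucc]; omega
        · rfl
      simp only [flagCell, Equiv.trans_apply, hiff]
    simp only [this]
    exact CharTwo.add_self_eq_zero _
  · rintro ⟨w, σ⟩ - - h
    have := Equiv.congr_fun (congrArg Prod.snd h) (σ.symm i.castSucc)
    simp [Fin.ext_iff] at this
  · simp
  · rintro ⟨w, σ⟩ -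
    ext <;> simp


/-- The other edge of the path `0, 1, …, n` at the chosen endpoint of the given edge; an edge
chosen at an end of the path is fixed. -/
def reflectEdge (e : Fin n × Bool) : Fin n × Bool :=
  if e.2 then (if h : (e.1 : ℕ) + 1 < n then (⟨e.1 + 1, h⟩, false) else e)
  else (if 0 < (e.1 : ℕ) then (⟨e.1 - 1, by omega⟩, true) else e)

theorem reflectEdge_reflectEdge (e : Fin n × Bool) : reflectEdge (reflectEdge e) = e := by
  obtain ⟨⟨q, hq⟩, s⟩ := e
  cases s
  · by_cases h : 0 < q
    · have : q - 1 + 1 = q := by omega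
      simp [reflectEdge, h, this, hq]
    · simp [reflectEdge, h]
  · by_cases h : q + 1 < n
    · simp [reflectEdge, h]
    · simp [reflectEdge, h]

theorem reflectEdge_endpoint (e : Fin n × Bool) :
    2 * ((reflectEdge e).1 : ℕ) + (if (reflectEdge e).2 then 2 else 0) =
      2 * (e.1 : ℕ) + if e.2 then 2 else 0 := by
  obtain ⟨⟨q, hq⟩, s⟩ := e
  cases s
  · by_cases h : 0 < q
    · simp [reflectEdge, h]; omega
    · simp [reflectEdge, h]
  · by_cases h : q + 1 < n
    · simp [reflectEdge, h]; omega
    · simp [reflectEdge, h]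

theorem endpoint_of_reflectEdge_eq_self {e : Fin n × Bool} (h : reflectEdge e = e) :
    (e.2 = true ∧ (e.1 : ℕ) + 1 = n) ∨ (e.2 = false ∧ (e.1 : ℕ) = 0) := by
  obtain ⟨⟨q, hq⟩, s⟩ := e
  cases s
  · right
    by_contra hne
    have : 0 < q := by simp at hne; omega
    simp [reflectEdge, this] at h
  · left
    by_contra hne
    have : q + 1 < n := by simp at hne; omega
    simp [reflectEdge, this] at h

theorem sum_labelDet_delete_last (L : (Fin (m + 1) → ℕ) → ℕ)
    (hbot : ∀ p (c : Fin (m + 1)), p c = 0 → L p ≠ c + 1) (htop : ∀ p c, p c = 2 * n → L p ≠ 0) :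
    ∑ φ : (Fin (m + 1) → Fin n × Bool) × Equiv.Perm (Fin (m + 1)),
      labelDet (fun a : Fin (m + 1) =>
        L (flagCell φ ((Fin.last (m + 1)).succAbove a : Fin (m + 2)))) =
    ∑ φ : (Fin (m + 1) → Fin n × Bool) × Equiv.Perm (Fin (m + 1)) with
        φ.2 (Fin.last m) = Fin.last m ∧ ((φ.1 (Fin.last m)).1 : ℕ) = 0 ∧
          (φ.1 (Fin.last m)).2 = false,
      labelDet (fun a : Fin (m + 1) => L (flagCell φ a)) := by
  simp only [Fin.succAbove_last, Fin.val_castSucc]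
  rw [← Finset.sum_filter_add_sum_filter_not Finset.univ (fun φ :
    (Fin (m + 1) → Fin n × Bool) × Equiv.Perm (Fin (m + 1)) =>
      φ.2 (Fin.last m) = Fin.last m ∧ ((φ.1 (Fin.last m)).1 : ℕ) = 0 ∧
          (φ.1 (Fin.last m)).2 = false), add_eq_left]
  have hopen : ∀ (σ : Equiv.Perm (Fin (m + 1))) (a : Fin (m + 1)),
      ¬ ((σ (σ.symm (Fin.last m)) : ℕ) < a) := by
    intro σ a
    simp only [Equiv.apply_symm_apply, Fin.val_last]
    omega
  refine Finset.sum_involution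
    (fun φ _ => (Function.update φ.1 (φ.2.symm (Fin.last m))
      (reflectEdge (φ.1 (φ.2.symm (Fin.last m)))), φ.2)) ?_ ?_ ?_ ?_
  · rintro ⟨w, σ⟩ -
    have : ∀ a : Fin (m + 1), flagCell (Function.update w (σ.symm (Fin.last m))
        (reflectEdge (w (σ.symm (Fin.last m)))), σ) a = flagCell (w, σ) a := by
      intro a
      funext c
      by_cases hc : c = σ.symm (Fin.last m)
      · subst hc
        simp only [flagCell, if_neg (hopen σ a), Function.update_self]
        exact reflectEdge_endpoint _
      · simp [flagCell, Function.update_of_ne hc]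
    simp only [this]
    exact CharTwo.add_self_eq_zero _
  · rintro ⟨w, σ⟩ hφ hne heq
    have hfix : reflectEdge (w (σ.symm (Fin.last m))) = w (σ.symm (Fin.last m)) := by
      simpa using congrFun (congrArg Prod.fst heq) (σ.symm (Fin.last m))
    apply hne
    rcases endpoint_of_reflectEdge_eq_self hfix with ⟨hs, hq⟩ | ⟨hs, hq⟩
    · refine labelDet_eq_zero_of_missing 0 fun a => htop _ (σ.symm (Fin.last m)) ?_
      simp only [flagCell, if_neg (hopen σ a), hs, if_true]
      omega
    · have hlast : σ.symm (Fin.last m) ≠ Fin.last m := by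
        intro h
        rw [h] at hs hq
        simp only [Finset.mem_filter] at hφ
        exact hφ.2 ⟨((Equiv.symm_apply_eq σ).1 h).symm, hq, hs⟩
      have hlt := Fin.val_lt_last hlast
      refine labelDet_eq_zero_of_missing ⟨σ.symm (Fin.last m) + 1, by omega⟩ fun a =>
        hbot _ (σ.symm (Fin.last m)) ?_
      simp only [flagCell, if_neg (hopen σ a), hs, hq]
      simp
  · rintro ⟨w, σ⟩ hφ
    simp only [Finset.mem_filter, Finset.mem_univ, true_and, not_and] at hφ ⊢
    intro hσ
    have hsymm : σ.symm (Fin.last m) = Fin.last m := by rw [Equiv.symm_apply_eq, hσ]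
    specialize hφ hσ
    rw [hsymm, Function.update_self]
    intro h0 h1
    by_cases hfix : reflectEdge (w (Fin.last m)) = w (Fin.last m)
    · rw [hfix] at h0 h1
      exact hφ h0 h1
    · have := reflectEdge_reflectEdge (w (Fin.last m))
      apply hfix
      have h2 : reflectEdge (reflectEdge (w (Fin.last m))) = reflectEdge (w (Fin.last m)) := by
        rw [reflectEdge, h1]
        simp [h0]
      exact h2.symm.trans this
  · rintro ⟨w, σ⟩ -
    simp [reflectEdge_reflectEdge]

/-- Extension of a permutation of `Fin m` to `Fin (m + 1)` fixing the last element. -/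
def extendPermLast (σ : Equiv.Perm (Fin m)) : Equiv.Perm (Fin (m + 1)) :=
  finSuccEquivLast.symm.permCongr (Equiv.optionCongr σ)

theorem extendPermLast_castSucc (σ : Equiv.Perm (Fin m)) (c : Fin m) :
    extendPermLast σ c.castSucc = (σ c).castSucc := by
  simp [extendPermLast, Equiv.permCongr_apply]

theorem extendPermLast_last (σ : Equiv.Perm (Fin m)) :
    extendPermLast σ (Fin.last m) = Fin.last m := by
  simp [extendPermLast, Equiv.permCongr_apply]

theorem exists_extendPermLast_eq {τ : Equiv.Perm (Fin (m + 1))}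
    (h : τ (Fin.last m) = Fin.last m) : ∃ σ, extendPermLast σ = τ := by
  have hne : ∀ c : Fin m, τ c.castSucc ≠ Fin.last m := fun c hc =>
    Fin.castSucc_ne_last c (τ.injective (hc.trans h.symm))
  have hinj : Function.Injective fun c : Fin m => (τ c.castSucc).castPred (hne c) := by
    intro a b hab
    simpa using hab
  refine ⟨Equiv.ofBijective _ (Finite.injective_iff_bijective.1 hinj), ?_⟩
  ext c
  induction c using Fin.lastCases with
  | last => rw [extendPermLast_last, h]
  | cast c => simp [extendPermLast_castSucc]

theorem sum_labelDet_bottom_face (hn : 0 < n) (L : (Fin (m + 1) → ℕ) → ℕ) :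
    ∑ φ : (Fin (m + 1) → Fin n × Bool) × Equiv.Perm (Fin (m + 1)) with
        φ.2 (Fin.last m) = Fin.last m ∧ ((φ.1 (Fin.last m)).1 : ℕ) = 0 ∧
          (φ.1 (Fin.last m)).2 = false,
      labelDet (fun a : Fin (m + 1) => L (flagCell φ a)) =
    ∑ φ : (Fin m → Fin n × Bool) × Equiv.Perm (Fin m),
      labelDet (fun a : Fin (m + 1) => L (Fin.snoc (α := fun _ => ℕ) (flagCell φ a) 0)) := by
  symm
  refine Finset.sum_bij (fun φ _ => (Fin.snoc (α := fun _ => Fin n × Bool) φ.1 (⟨0, hn⟩, false),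
    extendPermLast φ.2)) ?_ ?_ ?_ ?_
  · rintro ⟨w, σ⟩ -
    simp [extendPermLast_last]
  · rintro ⟨w, σ⟩ - ⟨w', σ'⟩ - h
    simp only [Prod.mk.injEq] at h ⊢
    refine ⟨(Fin.snoc_injective2 h.1).1, ?_⟩
    ext c
    have := Equiv.congr_fun h.2 c.castSucc
    rw [extendPermLast_castSucc, extendPermLast_castSucc] at this
    exact congrArg Fin.val (Fin.castSucc_injective _ this)
  · rintro ⟨w, τ⟩ hφ
    simp only [Finset.mem_filter, Finset.mem_univ, true_and] at hφ
    obtain ⟨hτ, h0, h1⟩ := hφ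
    obtain ⟨σ, rfl⟩ := exists_extendPermLast_eq hτ
    refine ⟨(Fin.init w, σ), Finset.mem_univ _, ?_⟩
    have : ((⟨0, hn⟩, false) : Fin n × Bool) = w (Fin.last m) := by
      ext
      · exact h0.symm
      · simp [h1]
    simp only [this, Fin.snoc_init_self]
  · rintro ⟨w, σ⟩ -
    congr 1
    funext a
    congr 1
    funext c
    induction c using Fin.lastCases with
    | last =>
      have : ¬ (m < (a : ℕ)) := by omega
      simp [flagCell, extendPermLast_last, this]
    | cast c => simp [flagCell, extendPermLast_castSucc]

/-- A cubical Sperner lemma: if labels in `{0, …, m}` of the cells of the grid `[0, n] ^ m` avoid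
`c + 1` on the lower face and `0` on the upper face in each direction `c`, then the number of
full flags of cells carrying all the labels is odd. -/
theorem sum_labelDet_flagCell_eq_one (hn : 0 < n) (L : (Fin m → ℕ) → ℕ) (hL : ∀ p, L p ≤ m)
    (hbot : ∀ p (c : Fin m), p c = 0 → L p ≠ c + 1) (htop : ∀ p c, p c = 2 * n → L p ≠ 0) :
    ∑ φ : (Fin m → Fin n × Bool) × Equiv.Perm (Fin m),
      labelDet (fun i : Fin (m + 1) => L (flagCell φ i)) = 1 := by
  induction m with
  | zero =>
    have h0 : ∀ p, L p = 0 := fun p => Nat.le_zero.1 (hL p)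
    simp [labelDet, h0]
  | succ m ih =>
    simp only [labelDet_eq_sum_succAbove _ fun _ => hL _]
    rw [Finset.sum_comm, Fin.sum_univ_castSucc, Fin.sum_univ_succ]
    rw [Fin.castSucc_zero, sum_labelDet_delete_first, zero_add, Finset.sum_eq_zero, zero_add,
      sum_labelDet_delete_last L hbot htop, sum_labelDet_bottom_face hn]
    · refine ih (fun p => L (Fin.snoc (α := fun _ => ℕ) p 0)) (fun p => ?_) (fun p c h => ?_)
        (fun p c h => ?_)
      · have h1 := hL (Fin.snoc (α := fun _ => ℕ) p 0)
        have h2 := hbot (Fin.snoc (α := fun _ => ℕ) p 0) (Fin.last m) (by simp)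
        simp only [Fin.val_last] at h2
        omega
      · simpa using hbot (Fin.snoc (α := fun _ => ℕ) p 0) c.castSucc (by simpa using h)
      · exact htop (Fin.snoc (α := fun _ => ℕ) p 0) c.castSucc (by simpa using h)
    · intro i _
      simpa only [Fin.succ_castSucc] using sum_labelDet_delete_middle L i

end Flags

theorem exists_flagCell_injective {m n : ℕ} (hn : 0 < n) (L : (Fin m → ℕ) → ℕ)
    (hL : ∀ p, L p ≤ m) (hbot : ∀ p (c : Fin m), p c = 0 → L p ≠ c + 1)
    (htop : ∀ p c, p c = 2 * n → L p ≠ 0) :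
    ∃ φ : (Fin m → Fin n × Bool) × Equiv.Perm (Fin m),
      Function.Injective fun i : Fin (m + 1) => L (flagCell φ i) := by
  obtain ⟨φ, -, hφ⟩ := Finset.exists_ne_zero_of_sum_ne_zero
    ((sum_labelDet_flagCell_eq_one hn L hL hbot htop).trans_ne one_ne_zero)
  exact ⟨φ, injective_of_labelDet_ne_zero hφ⟩

/-- The input value of process `j` at the grid point `a`: the largest `c + 1` with `j < a c`,
or `0` if there is none. -/
def gridInput {k : ℕ} (a : Fin k → ℕ) (j : ℕ) : ℕ :=
  Finset.univ.sup fun c : Fin k => if j < a c then (c : ℕ) + 1 else 0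

theorem gridInput_le {k : ℕ} (a : Fin k → ℕ) (j : ℕ) : gridInput a j ≤ k := by
  refine Finset.sup_le fun c _ => ?_
  split_ifs <;> omega

theorem gridInput_ne_of_eq_zero {k : ℕ} {a : Fin k → ℕ} {c : Fin k} (h : a c = 0) (j : ℕ) :
    gridInput a j ≠ c + 1 := by
  intro heq
  obtain ⟨d, -, hd⟩ := Finset.exists_mem_eq_sup Finset.univ ⟨c, Finset.mem_univ c⟩
    (fun c : Fin k => if j < a c then (c : ℕ) + 1 else 0)
  rw [gridInput, hd] at heq
  split_ifs at heq with hj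
  have : d = c := Fin.ext (by omega)
  subst this
  omega

theorem gridInput_ne_zero {k : ℕ} {a : Fin k → ℕ} {c : Fin k} {j : ℕ} (h : j < a c) :
    gridInput a j ≠ 0 := by
  have := Finset.le_sup (f := fun c : Fin k => if j < a c then (c : ℕ) + 1 else 0)
    (Finset.mem_univ c)
  simp only [h, if_true] at this
  rw [gridInput]
  omega

theorem view_congr {V I : Type*} {E : V → V → Prop} {x y : V → I} {i : V}
    (h : ∀ j, (j = i ∨ E j i) → x j = y j) : view E x i = view E y i := by
  funext j
  by_cases hj : j = i ∨ E j i
  · simp [view, hj, h j hj]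
  · simp [view, hj]

/-- Along a flag, the halved coordinates of the cells agree at process `j` with those of the
initial vertex unless `j` indexes an interval of the cell. -/
theorem gridInput_flagCell {k n : ℕ} (φ : (Fin k → Fin n × Bool) × Equiv.Perm (Fin k)) (i j : ℕ)
    (hj : ∀ c, flagCell φ i c ≠ 2 * j + 1) :
    gridInput (fun c => flagCell φ i c / 2) j = gridInput (fun c => flagCell φ 0 c / 2) j := by
  refine Finset.sup_congr rfl fun c _ => ?_
  have hiff : j < flagCell φ i c / 2 ↔ j < flagCell φ 0 c / 2 := by
    specialize hj c
    simp only [flagCell, Nat.not_lt_zero, if_false] at hj ⊢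
    split_ifs at hj ⊢ <;> omega
  simp only [hiff]

/-- If no `k` processes dominate the digraph `E`, then `k`-set agreement is not solvable on it. -/
theorem not_solvesSetAgreement_of_lt_card {n k : ℕ} (hn : 0 < n) {I : Type*}
    {E : Fin n → Fin n → Prop} (hI : ∃ g : Fin (k + 1) → I, Function.Injective g)
    (hdom : ∀ D : Finset (Fin n), IsDominating E D → k < D.card)
    (f : (i : Fin n) → (Fin n → Option I) → I) : ¬ SolvesSetAgreement k E f := by
  obtain ⟨g, hg⟩ := hI
  intro hf
  let X : (Fin k → ℕ) → Fin n → I := fun p j =>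
    g ⟨gridInput (fun c => p c / 2) j, Nat.lt_succ_of_le (gridInput_le _ _)⟩
  have hproc : ∀ p : Fin k → ℕ, ∃ i : Fin n, ∀ j, (j = i ∨ E j i) → ∀ c, p c ≠ 2 * j + 1 := by
    intro p
    classical
    by_contra! hcon
    let D : Finset (Fin n) := Finset.univ.filter fun j => ∃ c, p c = 2 * j + 1
    have hD : IsDominating E D := by
      intro v
      obtain ⟨j, hj, hc⟩ := hcon v
      rcases hj with rfl | hj
      · exact Or.inl (by simpa [D] using hc)
      · exact Or.inr ⟨j, by simpa [D] using hc, hj⟩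
    refine absurd (hdom D hD) (not_lt.2 ?_)
    have hsub : D.image (fun j : Fin n => 2 * (j : ℕ) + 1) ⊆ Finset.univ.image p := by
      intro y hy
      obtain ⟨j, hj, rfl⟩ := Finset.mem_image.1 hy
      obtain ⟨c, hc⟩ := (Finset.mem_filter.1 hj).2
      exact Finset.mem_image.2 ⟨c, Finset.mem_univ c, hc⟩
    have hinj : Function.Injective fun j : Fin n => 2 * (j : ℕ) + 1 := by
      intro a b hab
      exact Fin.ext (by simp only at hab; omega)
    calc D.card = (D.image fun j : Fin n => 2 * (j : ℕ) + 1).card :=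
          (Finset.card_image_of_injective _ hinj).symm
      _ ≤ (Finset.univ.image p).card := Finset.card_le_card hsub
      _ ≤ k := Finset.card_image_le.trans (by simp)
  choose proc hproc using hproc
  have hlabel : ∀ p : Fin k → ℕ, ∃ j : Fin n, X p j = f (proc p) (view E (X p) (proc p)) :=
    fun p => (hf (X p)).1 (proc p)
  choose wit hwit using hlabel
  obtain ⟨φ, hφ⟩ := exists_flagCell_injective hn
    (fun p : Fin k → ℕ => gridInput (fun c => p c / 2) (wit p)) (fun p => gridInput_le _ _)
    (fun p c h => gridInput_ne_of_eq_zero (by simp [h]) _)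
    (fun p c h => gridInput_ne_zero (c := c) (by have := (wit p).2; omega))
  let x := X (flagCell φ 0)
  have hview : ∀ i : Fin (k + 1), f (proc (flagCell φ i)) (view E x (proc (flagCell φ i))) =
      X (flagCell φ i) (wit (flagCell φ i)) := by
    intro i
    rw [hwit]
    congr 1
    refine view_congr fun j hj => ?_
    simp only [x, X, gridInput_flagCell φ i j (hproc _ j hj)]
  have hinj : Function.Injective fun i : Fin (k + 1) =>
      f (proc (flagCell φ i)) (view E x (proc (flagCell φ i))) := by
    intro a b hab
    simp only [hview] at hab
    exact hφ (Fin.mk.inj_iff.1 (hg hab))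
  have hsub : (Set.range fun i : Fin (k + 1) =>
      f (proc (flagCell φ i)) (view E x (proc (flagCell φ i)))) ⊆
      Set.range fun i : Fin n => f i (view E x i) := by
    rintro _ ⟨i, rfl⟩
    exact ⟨_, rfl⟩
  have hle := (Set.ncard_le_ncard hsub (Set.finite_range _)).trans (hf x).2
  rw [Set.ncard_range_of_injective hinj, Nat.card_eq_fintype_card, Fintype.card_fin] at hle
  omega

/-- **Theorem (lower bound for k-set agreement in dynamic networks).** If the information-flow
digraph of the `r`-round dynamic graph sequence `Gs` has no dominating set of cardinality at
most `k`, then no decision function solves `k`-set agreement on it; hence any algorithm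
solving `k`-set agreement against an adversary that can produce `Gs` needs more than `r`
rounds. -/
theorem setAgreement_dynamic_lower_bound {n k : ℕ} (hn : 1 ≤ n) (hk : 1 ≤ k)
    (r : ℕ) (Gs : ℕ → Fin n → Fin n → Prop) {I : Type*}
    (hI : ∃ g : Fin (k + 1) → I, Function.Injective g)
    (hdom : ∀ D : Finset (Fin n), IsDominating (infoFlow Gs r) D → k < D.card) :
    ∀ f : (i : Fin n) → (Fin n → Option I) → I,
      ¬ SolvesSetAgreement k (infoFlow Gs r) f := by
  exact fun f => not_solvesSetAgreement_of_lt_card hn hI hdom f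
end

section
/- Let n ≥ 2 and let E be a digraph on Fin n with no universal node (equivalently, by the characterization of consensus solvability, binary consensus is not solvable on E). Then for every real ε with 0 ≤ ε < 1/(n−1), no decision function f : (i : Fin n) → (Fin n → Option Bool) → ℝ solves ε-approximate agreement on E. -/
/-- The encoding of Boolean values as reals: `χ(false) = 0`, `χ(true) = 1`. -/
noncomputable def chi (b : Bool) : ℝ := if b then 1 else 0

/-- A decision function `f` solves `ε`-approximate agreement on the information-flow digraph
`E`: on constant inputs all processes output the (encoded) input value, and on every input
all output values are within `ε` of each other. -/
def SolvesApproxAgreement {n : ℕ} (E : Fin n → Fin n → Prop) (ε : ℝ)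
    (f : (i : Fin n) → (Fin n → Option Bool) → ℝ) : Prop :=
  ∀ x : Fin n → Bool,
    (∀ b : Bool, (∀ i : Fin n, x i = b) → ∀ i : Fin n, f i (view E x i) = chi b) ∧
    (∀ i j : Fin n, |f i (view E x i) - f j (view E x j)| ≤ ε)

/-- A process that does not hear `u` has the same view on inputs differing only at `u`. -/
theorem view_congr_of_not_hears {V I : Type*} {E : V → V → Prop} {x y : V → I} {u v : V}
    (hne : v ≠ u) (hE : ¬ E u v) (hxy : ∀ j, j ≠ u → x j = y j) :
    view E x v = view E y v := by
  funext j
  unfold view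
  split_ifs with hj
  · rw [hxy j (by rintro rfl; exact hj.elim (fun h => hne h.symm) hE)]
  · rfl

/-- **Theorem (impossibility of approximate agreement).** If the information-flow digraph `E`
has no universal node (equivalently, binary consensus is not solvable on `E`), then for every
`ε` with `0 ≤ ε < 1/(n-1)`, no decision function solves `ε`-approximate agreement on `E`. -/
theorem approxAgreement_impossible_of_no_universal_node {n : ℕ} (hn : 2 ≤ n)
    (E : Fin n → Fin n → Prop)
    (hU : ¬ ∃ u : Fin n, ∀ v : Fin n, v = u ∨ E u v)
    (ε : ℝ) (hε0 : 0 ≤ ε) (hε : ε < 1 / ((n : ℝ) - 1)) :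
    ∀ f : (i : Fin n) → (Fin n → Option Bool) → ℝ, ¬ SolvesApproxAgreement E ε f := by
  intro f hf
  have unheard : ∀ u : Fin n, ∃ v : Fin n, v ≠ u ∧ ¬ E u v := by
    simpa only [not_exists, not_forall, not_or] using hU
  choose v hne hE using unheard
  let x : ℕ → Fin n → Bool := fun k i => decide (i.val < k)
  have view_step : ∀ (k : ℕ) (hk : k < n),
      view E (x k) (v ⟨k, hk⟩) = view E (x (k + 1)) (v ⟨k, hk⟩) := fun k hk =>
    view_congr_of_not_hears (hne _) (hE _) fun j hj => by
      have hjk : j.val ≠ k := fun h => hj (Fin.ext h)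
      exact decide_eq_decide.mpr (by omega)
  have bound : ∀ (k : ℕ) (hk : k < n),
      f (v ⟨k, hk⟩) (view E (x k) (v ⟨k, hk⟩)) ≤ k * ε := by
    intro k
    induction k with
    | zero =>
      intro hk
      rw [(hf (x 0)).1 false (fun i => by simp [x])]
      simp [chi]
    | succ k ih =>
      intro hk
      have hprev := ih (by omega)
      rw [view_step] at hprev
      have hagree := (abs_le.mp ((hf (x (k + 1))).2 (v ⟨k + 1, hk⟩) (v ⟨k, by omega⟩))).2
      push_cast
      linarith
  obtain ⟨m, rfl⟩ : ∃ m, n = m + 1 := ⟨n - 1, by omega⟩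
  have hlast := bound m (by omega)
  rw [view_step, (hf (x (m + 1))).1 true (fun i => by simp only [x, i.isLt, decide_true])] at hlast
  have hm : (0 : ℝ) < m := by exact_mod_cast (by omega : 0 < m)
  rw [Nat.cast_add_one, add_sub_cancel_right, lt_div_iff₀ hm] at hε
  simp only [chi, if_true] at hlast
  linarith
end

section
/- Let n ≥ 2, let G be a simple graph on Fin n, let r ≥ 0, and let E_r be the r-th power digraph of G. If no vertex u of G has a walk of length at most r to every other vertex (i.e., E_r has no universal node), then for every real ε with 0 ≤ ε < 1/(n−1), no decision function f : (i : Fin n) → (Fin n → Option Bool) → ℝ solves ε-approximate agreement on E_r. Consequently, in the LOCAL model on the network G, any algorithm solving ε-approximate agreement with ε < 1/(n−1) needs strictly more than r rounds. -/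
/-- The `r`-th power digraph of a simple graph `G`: an arc from `u` to `v` iff `u ≠ v` and
there is a walk of length at most `r` from `u` to `v` in `G`. This is the information-flow
digraph of an `r`-round execution in the LOCAL model over the network `G`. -/
def powerDigraph {n : ℕ} (G : SimpleGraph (Fin n)) (r : ℕ) : Fin n → Fin n → Prop :=
  fun u v => u ≠ v ∧ ∃ w : G.Walk u v, w.length ≤ r

/-- A process that does not hear `u` has the same view of assignments agreeing outside `u`. -/
theorem view_eq_of_not_hears {V I : Type*} {E : V → V → Prop} {x y : V → I} {u v : V}
    (huv : ¬ (v = u ∨ E u v)) (hxy : ∀ j, j ≠ u → x j = y j) : view E x v = view E y v := by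
  funext j
  unfold view
  split_ifs with h
  · rw [hxy j]
    rintro rfl
    exact huv (h.imp Eq.symm id)
  · rfl

/-- Approximate agreement on a digraph without universal node has precision at least
`1 / (n - 1)`. -/
theorem SolvesApproxAgreement.one_le_mul {n : ℕ} (hn : 0 < n) {E : Fin n → Fin n → Prop}
    (hU : ¬ ∃ u : Fin n, ∀ v : Fin n, v = u ∨ E u v) {ε : ℝ}
    {f : (i : Fin n) → (Fin n → Option Bool) → ℝ} (hf : SolvesApproxAgreement E ε f) :
    1 ≤ ((n : ℝ) - 1) * ε := by
  push Not at hU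
  choose w hw using hU
  let x : ℕ → Fin n → Bool := fun k i => decide (i.val < k)
  have hview (k : ℕ) (hk : k < n) :
      view E (x k) (w ⟨k, hk⟩) = view E (x (k + 1)) (w ⟨k, hk⟩) := by
    refine view_eq_of_not_hears (u := ⟨k, hk⟩) (not_or.mpr (hw _)) fun j hj => ?_
    have : j.val ≠ k := fun h => hj (Fin.ext h)
    simp only [x, decide_eq_decide]
    omega
  have hbound (k : ℕ) (hk : k < n) :
      f (w ⟨k, hk⟩) (view E (x k) (w ⟨k, hk⟩)) ≤ k * ε := by
    induction k with
    | zero =>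
      rw [(hf (x 0)).1 false (fun i => by simp [x])]
      simp [chi]
    | succ k ih =>
      have h₁ := ih (by omega)
      rw [hview k (by omega)] at h₁
      have h₂ := (abs_le.mp ((hf (x (k + 1))).2 (w ⟨k + 1, hk⟩) (w ⟨k, by omega⟩))).2
      push_cast
      linarith
  obtain ⟨m, rfl⟩ := Nat.exists_eq_add_of_lt hn
  have h := hbound (0 + m) (by omega)
  rw [hview, (hf _).1 true (fun i => decide_eq_true i.isLt)] at h
  simpa [chi] using h

/-- **Theorem (lower bound for approximate agreement in the LOCAL model).** If no vertex of
`G` reaches every other vertex by a walk of length at most `r` (i.e., the `r`-th power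
digraph of `G` has no universal node), then for every `ε` with `0 ≤ ε < 1/(n-1)`, no decision
function solves `ε`-approximate agreement on the `r`-th power digraph; hence any LOCAL
algorithm solving `ε`-approximate agreement on `G` needs more than `r` rounds. -/
theorem approxAgreement_local_lower_bound {n : ℕ} (hn : 2 ≤ n)
    (G : SimpleGraph (Fin n)) (r : ℕ)
    (hU : ¬ ∃ u : Fin n, ∀ v : Fin n, v = u ∨ powerDigraph G r u v)
    (ε : ℝ) (hε0 : 0 ≤ ε) (hε : ε < 1 / ((n : ℝ) - 1)) :
    ∀ f : (i : Fin n) → (Fin n → Option Bool) → ℝ,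
      ¬ SolvesApproxAgreement (powerDigraph G r) ε f := by
  intro f hf
  have hpos : (0 : ℝ) < n - 1 := by
    have : (2 : ℝ) ≤ n := by exact_mod_cast hn
    linarith
  rw [lt_div_iff₀' hpos] at hε
  exact hε.not_ge (hf.one_le_mul (by omega) hU)
end

section
/- Let n ≥ 2 and define the digraph E on ZMod n by E i j ↔ (i ≠ j ∧ j ≠ i + 1), i.e., the complete digraph with the arcs of the directed Hamiltonian cycle i → i+1 removed. Then: (a) E has no universal node; and (b) the averaging decision function solves (1/(n−1))-approximate agreement on E: for every input x : ZMod n → Bool, setting g i = (∑_{j ≠ i−1} χ(x j)) / (n−1) (the average of the n−1 input values visible to process i, which depends only on view E x i), one has g i = χ(b) for all i whenever x is constantly b, and |g i − g j| ≤ 1/(n−1) for all i, j. In particular, the threshold 1/(n−1) in the approximate-agreement impossibility theorem is tight. -/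
/-- **Theorem (tightness of the approximate-agreement bound).** Let `E` be the digraph on
`ZMod n` obtained from the complete digraph by removing the arcs of the directed Hamiltonian
cycle `i → i + 1`. Then (a) `E` has no universal node (so consensus is unsolvable on `E`),
(b) the averaging function `g` (where each process averages the `n - 1` input values it
sees) depends only on the views, and (c) `g` solves `1/(n-1)`-approximate agreement:
it is valid on constant inputs and any two outputs differ by at most `1/(n-1)`. -/
theorem averaging_solves_inv_nsub1_approxAgreement {n : ℕ} (hn : 2 ≤ n) [NeZero n]
    (E : ZMod n → ZMod n → Prop) (hE : ∀ i j : ZMod n, E i j ↔ i ≠ j ∧ j ≠ i + 1)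
    (g : (ZMod n → Bool) → ZMod n → ℝ)
    (hg : ∀ (x : ZMod n → Bool) (i : ZMod n),
      g x i = (∑ j ∈ Finset.univ.erase (i - 1), chi (x j)) / ((n : ℝ) - 1)) :
    (¬ ∃ u : ZMod n, ∀ v : ZMod n, v = u ∨ E u v) ∧
    (∀ (x y : ZMod n → Bool) (i : ZMod n), view E x i = view E y i → g x i = g y i) ∧
    (∀ x : ZMod n → Bool,
      (∀ b : Bool, (∀ i : ZMod n, x i = b) → ∀ i : ZMod n, g x i = chi b) ∧
      (∀ i j : ZMod n, |g x i - g x j| ≤ 1 / ((n : ℝ) - 1))) := by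
  have hn1 : (0 : ℝ) < (n : ℝ) - 1 := by
    have : (2 : ℝ) ≤ n := by exact_mod_cast hn
    linarith
  have : Fact (1 < n) := ⟨hn⟩
  refine ⟨?_, ?_, ?_⟩
  · rintro ⟨u, hu⟩
    rcases hu (u + 1) with h | h
    · exact one_ne_zero (add_eq_left.mp h)
    · exact ((hE _ _).mp h).2 rfl
  · intro x y i h
    rw [hg, hg]
    congr 1
    refine Finset.sum_congr rfl fun j hj => ?_
    have hj' : j = i ∨ E j i := by
      by_cases hji : j = i
      · exact Or.inl hji
      · refine Or.inr ((hE _ _).mpr ⟨hji, fun hi => (Finset.mem_erase.mp hj).1 ?_⟩)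
        rw [hi, add_sub_cancel_right]
    have hv := congrFun h j
    simp only [view, if_pos hj', Option.some.injEq] at hv
    rw [hv]
  · intro x
    refine ⟨fun b hb i => ?_, fun i j => ?_⟩
    · rw [hg, div_eq_iff hn1.ne']
      simp only [hb]
      rw [Finset.sum_const, Finset.card_erase_of_mem (Finset.mem_univ _), Finset.card_univ,
        ZMod.card, nsmul_eq_mul, Nat.cast_sub (by omega), Nat.cast_one, mul_comm]
    · rw [hg, hg, ← sub_div, abs_div, abs_of_pos hn1]
      refine div_le_div_of_nonneg_right ?_ hn1.le
      rw [Finset.sum_erase_eq_sub (Finset.mem_univ _), Finset.sum_erase_eq_sub (Finset.mem_univ _),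
        sub_sub_sub_cancel_left]
      cases x (j - 1) <;> cases x (i - 1) <;> simp [chi]
end

section
/- Let n ≥ 2 and let E be a digraph on Fin n with no universal node. For each 0 ≤ j ≤ n, define the staircase input assignment x_j : Fin n → Bool by x_j i = true iff (i : ℕ) < j. Then for every j with 1 ≤ j ≤ n there exists a process q ∈ Fin n with view E x_{j−1} q = view E x_j q. (Hence the images of the staircase facets under the scissor-cut map Ξ form a chain in which every two consecutive facets of the protocol complex intersect.) -/
/-- The staircase input assignment `x_j : Fin n → Bool`, with `x_j i = true` iff `i < j`. -/
def staircase (n : ℕ) (j : ℕ) : Fin n → Bool := fun i => decide ((i : ℕ) < j)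

/-- **Lemma (staircase chain).** If the information-flow digraph `E` has no universal node,
then for every `1 ≤ j ≤ n` there is a process `q` whose view is the same under the staircase
input assignments `x_{j-1}` and `x_j`; hence the images of the staircase facets under the
scissor-cut map form a chain in which consecutive facets of the protocol complex
intersect. -/
theorem staircase_consecutive_views_intersect {n : ℕ} (hn : 2 ≤ n)
    (E : Fin n → Fin n → Prop)
    (hU : ¬ ∃ u : Fin n, ∀ v : Fin n, v = u ∨ E u v) :
    ∀ j : ℕ, 1 ≤ j → j ≤ n →
      ∃ q : Fin n, view E (staircase n (j - 1)) q = view E (staircase n j) q := by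
  intro j hj hjn
  push Not at hU
  obtain ⟨q, hne, hE⟩ := hU ⟨j - 1, by omega⟩
  refine ⟨q, funext fun i => ?_⟩
  by_cases h : i = q ∨ E i q
  · have hi : (i : ℕ) ≠ j - 1 := by
      intro hij
      rw [show i = ⟨j - 1, by omega⟩ from Fin.ext hij] at h
      exact h.elim (fun e => hne e.symm) hE
    have hlt : (i : ℕ) < j - 1 ↔ (i : ℕ) < j := by omega
    simp only [view, staircase, hlt]
  · simp only [view, if_neg h]
end
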